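/- Let A be a smooth countable saturated structure and let B be a substructure of A isomorphic to A. Then there exists an extension Ã of A such that Ã is isomorphic to A and both A and B are superhomogeneous substructures of Ã. -/

import Mathlib

open FirstOrder Language Set Cardinal Topology

universe u v w

namespace Paper

/-- The topology of pointwise convergence on `X → X` (product topology, `X` discrete). -/
def ptTop (X : Type*) : TopologicalSpace (X → X) :=
  ⨅ x : X, TopologicalSpace.induced (fun f => f x) ⊥

/-- The topology of pointwise convergence on the symmetric group on `X`
(subspace topology inherited from `X → X`). -/
def symTop (X : Type*) : TopologicalSpace (Equiv.Perm X) :=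
  TopologicalSpace.induced (fun g : Equiv.Perm X => ⇑g) (ptTop X)

/-- The subspace topology (of the topology of pointwise convergence) on a
permutation group on `X`. -/
def subgroupTop {X : Type*} (H : Subgroup (Equiv.Perm X)) : TopologicalSpace H :=
  TopologicalSpace.induced (fun h : H => (⇑(h : Equiv.Perm X) : X → X)) (ptTop X)

/-- The subspace topology (of the topology of pointwise convergence) on a
transformation monoid on `X`. -/
def submonoidTop {X : Type*} (N : Submonoid (Function.End X)) : TopologicalSpace N :=
  TopologicalSpace.induced (fun n : N => ((n : Function.End X) : X → X)) (ptTop X)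

variable (L : FirstOrder.Language.{u, v}) (M : Type w) [L.Structure M]

/-- The monoid of self-embeddings of a structure, as a submonoid of `Function.End M`. -/
def embM : Submonoid (Function.End M) where
  carrier := {f | ∃ e : M ↪[L] M, ⇑e = f}
  one_mem' := ⟨Embedding.refl L M, rfl⟩
  mul_mem' := by
    rintro f g ⟨e₁, rfl⟩ ⟨e₂, rfl⟩
    exact ⟨e₁.comp e₂, rfl⟩

/-- The monoid of elementary self-embeddings of a structure, as a submonoid of
`Function.End M`. -/
def eembM : Submonoid (Function.End M) where
  carrier := {f | ∃ e : M ↪ₑ[L] M, ⇑e = f}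
  one_mem' := ⟨ElementaryEmbedding.refl L M, rfl⟩
  mul_mem' := by
    rintro f g ⟨e₁, rfl⟩ ⟨e₂, rfl⟩
    exact ⟨e₁.comp e₂, rfl⟩

/-- The automorphism group of a structure, as a subgroup of `Equiv.Perm M`. -/
def autG : Subgroup (Equiv.Perm M) where
  carrier := {g | ∃ e : M ≃[L] M, ⇑e = ⇑g}
  one_mem' := ⟨Language.Equiv.refl L M, rfl⟩
  mul_mem' := by
    rintro g h ⟨e₁, he₁⟩ ⟨e₂, he₂⟩
    exact ⟨e₁.comp e₂, funext fun x => by simp [he₁, he₂]⟩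
  inv_mem' := by
    rintro g ⟨e, he⟩
    refine ⟨e.symm, funext fun x => e.injective ?_⟩
    rw [Language.Equiv.apply_symm_apply, he]
    simp



variable (L : FirstOrder.Language.{u, v}) (M : Type w) [L.Structure M]

/-- `M` is `κ`-saturated: for every tuple `ā` over `M` of length `< κ`, every elementary
extension `N` of `M` and every `b ∈ N` there is `c ∈ M` with `(N, āb) ≡ (M, āc)`. -/
def IsSaturatedAt (κ : Cardinal.{w}) : Prop :=
  ∀ (α : Type w), #α < κ →
    ∀ (N : Type w) (_ : L.Structure N) (e : M ↪ₑ[L] N) (a : α → M) (b : N),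
      ∃ c : M, ∀ φ : L.Formula (α ⊕ Unit),
        φ.Realize (Sum.elim (⇑e ∘ a) fun _ => b) ↔ φ.Realize (Sum.elim a fun _ => c)

/-- `M` is saturated if it is `|M|`-saturated. -/
def IsSaturated : Prop := IsSaturatedAt L M #M

/-- A substructure `V` of `M` is superhomogeneous in `M` if (1) every local isomorphism of `V`
(an isomorphism between finitely generated substructures of `V`) extends to an automorphism
of `M` whose restriction to `V` is an automorphism of `V`, and (2) for every `y ∉ V` there is
an automorphism of `M` fixing `V` pointwise that moves `y`. -/
def IsSuperhomogeneous (V : L.Substructure M) : Prop :=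
  (∀ (S : L.Substructure M), S ≤ V → S.FG → ∀ f : S ↪[L] M, (∀ s : S, f s ∈ V) →
      ∃ g : M ≃[L] M, (∀ s : S, g s = f s) ∧ ⇑g '' (V : Set M) = (V : Set M)) ∧
  (∀ y : M, y ∉ V → ∃ g : M ≃[L] M, (∀ v ∈ V, g v = v) ∧ g y ≠ y)

/-- The theory of `M` has quantifier elimination: every formula is equivalent, modulo the
theory of `M`, to a quantifier-free formula. -/
def HasQE : Prop :=
  ∀ (n : ℕ) (φ : L.Formula (Fin n)), ∃ ψ : L.Formula (Fin n),
    ψ.IsQF ∧ (φ ⇔[L.completeTheory M] ψ)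

/-- A countable saturated structure is smooth if its signature is countable and its theory
has quantifier elimination. -/
def Smooth : Prop :=
  L.card ≤ ℵ₀ ∧ Countable M ∧ IsSaturated L M ∧ HasQE L M

/-- The center of the automorphism group of `M` is trivial. -/
def TrivialAutCenter : Prop :=
  ∀ e : M ≃[L] M, (∀ g : M ≃[L] M, ∀ x : M, e (g x) = g (e x)) → ∀ x : M, e x = x

/-- The language with a single relation symbol of arity `n`. -/
def oneRel (n : ℕ) : FirstOrder.Language :=
  ⟨fun _ => Empty, fun m => PLift (m = n)⟩

/-- The structure on `M` over `oneRel n` given by interpreting the relation symbol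
as `R ⊆ Mⁿ`. -/
def oneRelStructure {n : ℕ} {M : Type w} (R : Set (Fin n → M)) : (oneRel n).Structure M where
  funMap := fun f _ => f.elim
  RelMap := fun {m} r v => R (fun i => v (Fin.cast r.down.symm i))

/-- A structure `M` is splendid if for every extension of the language by a single relation
symbol `ρ` and every structure `N` for the extended language whose reduct is elementarily
equivalent to `M`, the symbol `ρ` can be interpreted in `M` in such a way that the resulting
expansion is elementarily equivalent to `N`. -/
def Splendid : Prop :=
  ∀ (n : ℕ) (N : Type w) (SN : L.Structure N) (RN : Set (Fin n → N)),
    (letI := SN; M ≅[L] N) →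
    ∃ RM : Set (Fin n → M),
      letI := SN
      letI : (oneRel n).Structure N := oneRelStructure RN
      letI : (oneRel n).Structure M := oneRelStructure RM
      M ≅[L.sum (oneRel n)] N

/-- A structure `M` is `κ`-big if all of its expansions by constants `(M, ā)`, for tuples `ā`
of length `< κ`, are splendid. -/
def IsBig (κ : Cardinal.{w}) : Prop :=
  ∀ (α : Type w), #α < κ → ∀ a : α → M,
    letI : (constantsOn α).Structure M := constantsOn.structure a
    Splendid (L[[α]]) M


section ElementaryRelations

variable {L : FirstOrder.Language.{u, v}} {P : Type*} [L.Structure P]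

variable (L) in
/-- A binary relation on a structure is elementary if tuples that are related entrywise satisfy
the same formulas. -/
def IsElementaryRel (R : Set (P × P)) : Prop :=
  ∀ (n : ℕ) (φ : L.Formula (Fin n)) (x y : Fin n → P), (∀ i, (x i, y i) ∈ R) →
    (φ.Realize x ↔ φ.Realize y)

theorem realize_iff_of_fin {M N : Type*} [L.Structure M] [L.Structure N] {α : Type*}
    (x : α → M) (y : α → N)
    (h : ∀ (n : ℕ) (φ : L.Formula (Fin n)) (g : Fin n → α),
      φ.Realize (x ∘ g) ↔ φ.Realize (y ∘ g)) (φ : L.Formula α) :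
    φ.Realize x ↔ φ.Realize y := by
  classical
  let e := Fintype.equivFin φ.freeVarFinset
  have key := h _ (Formula.relabel e (φ.restrictFreeVar id : L.Formula φ.freeVarFinset))
    (Subtype.val ∘ e.symm)
  have he : (Subtype.val ∘ e.symm) ∘ e = (Subtype.val : φ.freeVarFinset → α) := by
    funext i
    simp
  rw [Formula.realize_relabel, Formula.realize_relabel, Function.comp_assoc, he,
    Function.comp_assoc, he] at key
  have hx := BoundedFormula.realize_restrictFreeVar (φ := φ) (f := id)
    (v := x ∘ Subtype.val) (xs := default) x (fun _ => rfl)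
  have hy := BoundedFormula.realize_restrictFreeVar (φ := φ) (f := id)
    (v := y ∘ Subtype.val) (xs := default) y (fun _ => rfl)
  exact hx.symm.trans (key.trans hy)

theorem IsElementaryRel.realize_iff {R : Set (P × P)} (hR : IsElementaryRel L R) {α : Type*}
    {x y : α → P} (hxy : ∀ i, (x i, y i) ∈ R) (φ : L.Formula α) :
    φ.Realize x ↔ φ.Realize y :=
  realize_iff_of_fin x y (fun n φ g => hR n φ _ _ fun i => hxy (g i)) φ

theorem IsElementaryRel.mono {R R' : Set (P × P)} (hR : IsElementaryRel L R) (h : R' ⊆ R) :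
    IsElementaryRel L R' := fun n φ x y hxy => hR n φ x y fun i => h (hxy i)

theorem IsElementaryRel.swap {R : Set (P × P)} (hR : IsElementaryRel L R) :
    IsElementaryRel L (Prod.swap ⁻¹' R) := fun n φ x y hxy => (hR n φ y x hxy).symm

theorem IsElementaryRel.eq_iff {R : Set (P × P)} (hR : IsElementaryRel L R) {x y x' y' : P}
    (h : (x, y) ∈ R) (h' : (x', y') ∈ R) : x = x' ↔ y = y' := by
  have := hR 2 ((Term.var 0).equal (Term.var 1)) ![x, x'] ![y, y'] (by
    intro i; fin_cases i <;> simpa)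
  simpa [Formula.realize_equal] using this

theorem IsElementaryRel.iUnion {R : ℕ → Set (P × P)} (hmono : Monotone R)
    (hR : ∀ k, IsElementaryRel L (R k)) : IsElementaryRel L (⋃ k, R k) := by
  intro n φ x y hxy
  choose k hk using fun i => mem_iUnion.1 (hxy i)
  exact hR (Finset.univ.sup k) n φ x y fun i =>
    hmono (Finset.le_sup (Finset.mem_univ i)) (hk i)

theorem IsElementaryRel.insert {R : Set (P × P)} {m m' : P}
    (h : ∀ φ : L.Formula (R ⊕ Unit), φ.Realize (Sum.elim (fun r : R => r.1.1) fun _ => m) ↔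
      φ.Realize (Sum.elim (fun r : R => r.1.2) fun _ => m')) :
    IsElementaryRel L (insert (m, m') R) := by
  intro n φ x y hxy
  have : ∀ i, ∃ c : R ⊕ Unit, x i = Sum.elim (fun r : R => r.1.1) (fun _ => m) c ∧
      y i = Sum.elim (fun r : R => r.1.2) (fun _ => m') c := by
    intro i
    rcases hxy i with h | h
    · exact ⟨Sum.inr (), by simpa using h⟩
    · exact ⟨Sum.inl ⟨_, h⟩, rfl, rfl⟩
  choose c hx hy using this
  rw [show x = _ ∘ c from funext hx, show y = _ ∘ c from funext hy,
    ← Formula.realize_relabel, ← Formula.realize_relabel]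
  exact h _

theorem isElementaryRel_empty : IsElementaryRel L (∅ : Set (P × P)) := by
  intro n φ x y hxy
  rcases n with _ | n
  · rw [Subsingleton.elim x y]
  · exact (hxy 0).elim

variable (L) in
/-- `F` is the graph of an elementary permutation of the set `N`. -/
structure IsElementaryPerm (N : Set P) (F : Set (P × P)) : Prop where
  isElementaryRel : IsElementaryRel L F
  mem : ∀ p ∈ F, p.1 ∈ N ∧ p.2 ∈ N
  exists_right : ∀ x ∈ N, ∃ y, (x, y) ∈ F
  exists_left : ∀ y ∈ N, ∃ x, (x, y) ∈ F

/-- A permutation of a larger set extending a permutation of `C` preserves `C`. -/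
theorem IsElementaryPerm.mem_iff {C : Set P} {F G : Set (P × P)} (hG : IsElementaryPerm L C G)
    (hF : IsElementaryRel L F) (hGF : G ⊆ F) {p : P × P} (hp : p ∈ F) : p.1 ∈ C ↔ p.2 ∈ C := by
  constructor
  · intro h
    obtain ⟨y, hy⟩ := hG.exists_right _ h
    rw [(hF.eq_iff hp (hGF hy)).1 rfl]
    exact (hG.mem _ hy).2
  · intro h
    obtain ⟨x, hx⟩ := hG.exists_left _ h
    rw [(hF.eq_iff hp (hGF hx)).2 rfl]
    exact (hG.mem _ hx).1

/-- Back-and-forth: if every relation in a class `Q` can be extended within `Q` to have any given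
element of `X` in its domain and any given element of `Y` in its range, then any member of `Q` is
the start of an increasing chain in `Q` whose union has domain containing `X` and range
containing `Y`. -/
theorem exists_chain {Q : Set (P × P) → Prop} {X Y : Set P} (hX : X.Countable)
    (hY : Y.Countable)
    (forth : ∀ R, Q R → ∀ x ∈ X, ∃ y, Q (insert (x, y) R))
    (back : ∀ R, Q R → ∀ y ∈ Y, ∃ x, Q (insert (x, y) R))
    {R₀ : Set (P × P)} (h₀ : Q R₀) :
    ∃ R : ℕ → Set (P × P), Monotone R ∧ R 0 = R₀ ∧ (∀ k, Q (R k)) ∧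
      (∀ x ∈ X, ∃ y, (x, y) ∈ ⋃ k, R k) ∧ ∀ y ∈ Y, ∃ x, (x, y) ∈ ⋃ k, R k := by
  have : Countable (X ⊕ Y) := by
    have := hX.to_subtype
    have := hY.to_subtype
    infer_instance
  have step : ∀ (R : {R // Q R}) (c : X ⊕ Y), ∃ R' : {R // Q R}, R.1 ⊆ R'.1 ∧
      (∀ x : X, c = Sum.inl x → ∃ y, (x.1, y) ∈ R'.1) ∧
      ∀ y : Y, c = Sum.inr y → ∃ x, (x, y.1) ∈ R'.1 := by
    rintro ⟨R, hR⟩ (x | y)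
    · obtain ⟨y, hy⟩ := forth R hR x x.2
      exact ⟨⟨_, hy⟩, subset_insert _ _, by rintro _ ⟨⟩; exact ⟨y, mem_insert _ _⟩, by simp⟩
    · obtain ⟨x, hx⟩ := back R hR y y.2
      exact ⟨⟨_, hx⟩, subset_insert _ _, by simp, by rintro _ ⟨⟩; exact ⟨x, mem_insert _ _⟩⟩
  choose f hf hfX hfY using step
  rcases isEmpty_or_nonempty (X ⊕ Y) with hE | hN
  · exact ⟨fun _ => R₀, monotone_const, rfl, fun _ => h₀,
      fun x hx => (hE.false (Sum.inl ⟨x, hx⟩)).elim, fun y hy => (hE.false (Sum.inr ⟨y, hy⟩)).elim⟩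
  obtain ⟨s, hs⟩ := exists_surjective_nat (X ⊕ Y)
  let R : ℕ → {R // Q R} := fun n => Nat.rec ⟨R₀, h₀⟩ (fun n r => f r (s n)) n
  refine ⟨fun n => (R n).1, monotone_nat_of_le_succ fun n => hf (R n) (s n), rfl,
    fun k => (R k).2, fun x hx => ?_, fun y hy => ?_⟩
  · obtain ⟨n, hn⟩ := hs (Sum.inl ⟨x, hx⟩)
    obtain ⟨y, hy⟩ := hfX (R n) (s n) _ hn
    exact ⟨y, mem_iUnion.2 ⟨n + 1, hy⟩⟩
  · obtain ⟨n, hn⟩ := hs (Sum.inr ⟨y, hy⟩)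
    obtain ⟨x, hx⟩ := hfY (R n) (s n) _ hn
    exact ⟨x, mem_iUnion.2 ⟨n + 1, hx⟩⟩

variable (L P) in
/-- Countable homogeneity: a countable elementary relation can be extended to have any given
element in its domain. -/
def IsCountablyHomogeneous : Prop :=
  ∀ R : Set (P × P), R.Countable → IsElementaryRel L R → ∀ m : P, ∃ m' : P,
    IsElementaryRel L (insert (m, m') R)

theorem IsCountablyHomogeneous.back (hP : IsCountablyHomogeneous L P) {R : Set (P × P)}
    (hc : R.Countable) (hR : IsElementaryRel L R) (m : P) :
    ∃ m' : P, IsElementaryRel L (insert (m', m) R) := by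
  obtain ⟨m', hm'⟩ := hP (Prod.swap ⁻¹' R) (hc.preimage Prod.swap_injective) hR.swap m
  refine ⟨m', hm'.swap.mono ?_⟩
  rintro p (rfl | hp)
  · exact Or.inl rfl
  · exact Or.inr hp

theorem IsCountablyHomogeneous.exists_extension (hP : IsCountablyHomogeneous L P)
    {R : Set (P × P)} (hc : R.Countable) (hR : IsElementaryRel L R) {S : Set P}
    (hS : S.Countable) :
    ∃ R' : Set (P × P), R ⊆ R' ∧ R'.Countable ∧ IsElementaryRel L R' ∧
      (∀ x ∈ S, ∃ y, (x, y) ∈ R') ∧ ∀ y ∈ S, ∃ x, (x, y) ∈ R' := by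
  obtain ⟨F, hmono, h0, hF, hX, hY⟩ := exists_chain
    (Q := fun R : Set (P × P) => R.Countable ∧ IsElementaryRel L R) hS hS
    (fun R hR x _ => (hP R hR.1 hR.2 x).imp fun y hy => ⟨hR.1.insert _, hy⟩)
    (fun R hR y _ => (hP.back hR.1 hR.2 y).imp fun x hx => ⟨hR.1.insert _, hx⟩) ⟨hc, hR⟩
  exact ⟨⋃ k, F k, h0 ▸ subset_iUnion F 0, countable_iUnion fun k => (hF k).1,
    IsElementaryRel.iUnion hmono fun k => (hF k).2, hX, hY⟩

/-- Given countably many requirements attached to each countable set, there is a countable set `N`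
such that each required relation over a finite subset of `N` extends to an elementary relation
with domain and range `N`. -/
theorem IsCountablyHomogeneous.exists_closed (hP : IsCountablyHomogeneous L P)
    (Act : Set P → Set (Set (P × P))) (hmono : Monotone Act)
    (hAct : ∀ S : Set P, S.Countable → (Act S).Countable)
    (hgood : ∀ S, ∀ R ∈ Act S, R.Countable ∧ IsElementaryRel L R)
    (S₀ : Set P) (hS₀ : S₀.Countable) :
    ∃ N : Set P, S₀ ⊆ N ∧ N.Countable ∧ ∀ T : Set P, T.Finite → T ⊆ N → ∀ R ∈ Act T,
      ∃ F : Set (P × P), R ⊆ F ∧ IsElementaryPerm L N F := by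
  have h : ∀ (R : Set (P × P)) (S : Set P), ∃ R' : Set (P × P),
      R.Countable → IsElementaryRel L R → S.Countable → R ⊆ R' ∧ R'.Countable ∧
      IsElementaryRel L R' ∧ (∀ x ∈ S, ∃ y, (x, y) ∈ R') ∧ ∀ y ∈ S, ∃ x, (x, y) ∈ R' := by
    intro R S
    by_cases hR : R.Countable ∧ IsElementaryRel L R ∧ S.Countable
    · obtain ⟨R', hR'⟩ := hP.exists_extension hR.1 hR.2.1 hR.2.2
      exact ⟨R', fun _ _ _ => hR'⟩
    · exact ⟨R, fun h1 h2 h3 => (hR ⟨h1, h2, h3⟩).elim⟩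
  choose ext hext using h
  let step : Set P × (Set (P × P) → Set (P × P)) → Set P × (Set (P × P) → Set (P × P)) :=
    fun s => (s.1 ∪ ⋃ R ∈ Act s.1, (Prod.fst '' s.2 R ∪ Prod.snd '' s.2 R),
      fun R => ext (s.2 R) s.1)
  let st : ℕ → Set P × (Set (P × P) → Set (P × P)) := fun n =>
    Nat.rec (S₀, id) (fun _ s => step s) n
  have hst : ∀ n, st (n + 1) = step (st n) := fun _ => rfl
  have inv : ∀ n, (st n).1.Countable ∧ ∀ R : Set (P × P), R.Countable → IsElementaryRel L R →
      ((st n).2 R).Countable ∧ IsElementaryRel L ((st n).2 R) := by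
    intro n
    induction n with
    | zero => exact ⟨hS₀, fun R h1 h2 => ⟨h1, h2⟩⟩
    | succ n ih =>
      rw [hst]
      refine ⟨ih.1.union ((hAct _ ih.1).biUnion fun R hR => ?_), fun R h1 h2 => ?_⟩
      · have := (ih.2 R (hgood _ R hR).1 (hgood _ R hR).2).1
        exact (this.image _).union (this.image _)
      · have := hext ((st n).2 R) (st n).1 (ih.2 R h1 h2).1 (ih.2 R h1 h2).2 ih.1
        exact ⟨this.2.1, this.2.2.1⟩
  have hN : Monotone fun n => (st n).1 := monotone_nat_of_le_succ fun n => subset_union_left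
  refine ⟨⋃ n, (st n).1, subset_iUnion (fun n => (st n).1) 0, countable_iUnion fun n => (inv n).1,
    fun T hT hTN R hR => ?_⟩
  obtain ⟨k, hk⟩ : ∃ k, T ⊆ (st k).1 := by
    have := hT.to_subtype
    choose f hf using fun t : T => mem_iUnion.1 (hTN t.2)
    obtain ⟨k, hk⟩ := (Set.finite_range f).bddAbove
    exact ⟨k, fun t ht => hN (hk ⟨⟨t, ht⟩, rfl⟩) (hf ⟨t, ht⟩)⟩
  obtain ⟨hRc, hRe⟩ := hgood T R hR
  have hext' := fun n => hext ((st n).2 R) (st n).1 ((inv n).2 R hRc hRe).1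
    ((inv n).2 R hRc hRe).2 (inv n).1
  have hF : Monotone fun n => (st n).2 R := monotone_nat_of_le_succ fun n => (hext' n).1
  refine ⟨⋃ n, (st n).2 R, subset_iUnion (fun n => (st n).2 R) 0,
    IsElementaryRel.iUnion hF fun n => ((inv n).2 R hRc hRe).2, fun p hp => ?_, fun x hx => ?_,
    fun y hy => ?_⟩
  · obtain ⟨n, hn⟩ := mem_iUnion.1 hp
    have hp' : p ∈ (st (max k n)).2 R := hF (le_max_right k n) hn
    have hR' : R ∈ Act (st (max k n)).1 := hmono (hk.trans (hN (le_max_left k n))) hR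
    exact ⟨mem_iUnion.2 ⟨max k n + 1, Or.inr (mem_biUnion hR' (Or.inl ⟨p, hp', rfl⟩))⟩,
      mem_iUnion.2 ⟨max k n + 1, Or.inr (mem_biUnion hR' (Or.inr ⟨p, hp', rfl⟩))⟩⟩
  · obtain ⟨n, hn⟩ := mem_iUnion.1 hx
    obtain ⟨y, hy⟩ := (hext' n).2.2.2.1 x hn
    exact ⟨y, mem_iUnion.2 ⟨n + 1, hy⟩⟩
  · obtain ⟨n, hn⟩ := mem_iUnion.1 hy
    obtain ⟨x, hx⟩ := (hext' n).2.2.2.2 y hn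
    exact ⟨x, mem_iUnion.2 ⟨n + 1, hx⟩⟩

end ElementaryRelations

section Ultrapower

open Filter

theorem exists_diagonal {V : Type*} (p : ℕ → ℕ → V → Prop)
    (h : ∀ k, ∀ᶠ n in (hyperfilter ℕ : Filter ℕ), ∃ v, ∀ j < k, p j n v) [Nonempty V] :
    ∃ w : ℕ → V, ∀ j, ∀ᶠ n in (hyperfilter ℕ : Filter ℕ), p j n (w n) := by
  classical
  let K : ℕ → ℕ := fun n => Nat.findGreatest (fun k => ∃ v, ∀ j < k, p j n v) n
  have hK : ∀ n, ∃ v, ∀ j < K n, p j n v := fun n =>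
    Nat.findGreatest_spec (P := fun k => ∃ v, ∀ j < k, p j n v) (Nat.zero_le n)
      ⟨Classical.arbitrary V, by simp⟩
  choose w hw using hK
  refine ⟨w, fun j => ?_⟩
  have hj : ∀ᶠ n in (hyperfilter ℕ : Filter ℕ), j + 1 ≤ n :=
    (Nat.hyperfilter_le_atTop : _) (eventually_ge_atTop (j + 1))
  filter_upwards [h (j + 1), hj] with n hn hjn
  exact hw n j (Nat.le_findGreatest hjn hn)

/-- The ultrapower of `A` by a nonprincipal ultrafilter on `ℕ`. -/
abbrev UPow (A : Type*) : Type _ := ((hyperfilter ℕ : Ultrafilter ℕ) : Filter ℕ).Product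
  fun _ : ℕ => A

variable {L : FirstOrder.Language.{u, v}} {A : Type w} [L.Structure A] [Nonempty A]

theorem UPow.exists_realize [Countable L.Symbols] {β : Type*} [Countable β] (c : β → UPow A)
    (Φ : Set (L.Formula (β ⊕ Unit)))
    (h : ∀ s : Set (L.Formula (β ⊕ Unit)), s.Finite → s ⊆ Φ →
      ∃ m, ∀ φ ∈ s, φ.Realize (Sum.elim c fun _ => m)) :
    ∃ m, ∀ φ ∈ Φ, φ.Realize (Sum.elim c fun _ => m) := by
  rcases Φ.eq_empty_or_nonempty with rfl | hne
  · exact h ∅ finite_empty subset_rfl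
  have hmk : ∀ m : UPow A, ∃ f : ℕ → A, (f : UPow A) = m := Quotient.exists_rep
  choose c' hc' using fun b => hmk (c b)
  have los : ∀ (φ : L.Formula (β ⊕ Unit)) (f : ℕ → A),
      φ.Realize (Sum.elim c fun _ => (f : UPow A)) ↔
      ∀ᶠ n in (hyperfilter ℕ : Filter ℕ),
        φ.Realize (Sum.elim (fun b => c' b n) fun _ => f n) := by
    intro φ f
    have := Ultraproduct.realize_formula_cast (u := hyperfilter ℕ) φ
      (Sum.elim c' fun _ => f : β ⊕ Unit → ℕ → A)
    have e₁ : (Sum.elim c fun _ => (f : UPow A)) =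
        fun i => ((Sum.elim c' fun _ => f : β ⊕ Unit → ℕ → A) i : UPow A) := by
      funext i
      rcases i with b | _
      · exact (hc' b).symm
      · rfl
    rw [e₁]
    refine this.trans (eventually_congr <| Eventually.of_forall fun n => iff_of_eq (congrArg _ ?_))
    funext i
    rcases i with b | _ <;> rfl
  obtain ⟨e, he⟩ := (Φ.to_countable).exists_eq_range hne
  obtain ⟨w, hw⟩ := exists_diagonal
    (fun j n v => (e j).Realize (Sum.elim (fun b => c' b n) fun _ => v)) (by
      intro k
      obtain ⟨m, hm⟩ := h (e '' Set.Iio k) ((Set.finite_Iio k).image e)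
        (by rw [he]; exact image_subset_range _ _)
      obtain ⟨f, rfl⟩ := hmk m
      have : ∀ᶠ n in (hyperfilter ℕ : Filter ℕ), ∀ j ∈ Set.Iio k,
          (e j).Realize (Sum.elim (fun b => c' b n) fun _ => f n) :=
        (eventually_all_finite (Set.finite_Iio k)).2 fun j hj =>
          (los _ _).1 (hm _ (mem_image_of_mem e hj))
      exact this.mono fun n hn => ⟨f n, fun j hj => hn j hj⟩)
  refine ⟨(w : UPow A), fun φ hφ => ?_⟩
  rw [he] at hφ
  obtain ⟨j, rfl⟩ := hφ
  exact (los _ _).2 (hw j)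

theorem UPow.isCountablyHomogeneous [Countable L.Symbols] :
    IsCountablyHomogeneous L (UPow A) := by
  intro R hc hR m
  have := hc.to_subtype
  obtain ⟨m', hm'⟩ := UPow.exists_realize (L := L) (fun r : R => r.1.2)
    {φ | φ.Realize (Sum.elim (fun r : R => r.1.1) fun _ => m)} (by
      intro s hs hsub
      have := hs.to_subtype
      have key := hR.realize_iff (x := fun r : R => r.1.1) (y := fun r : R => r.1.2)
        (fun r => r.2) ((Formula.iInf fun φ : s => φ.1).iExs Unit)
      rw [Formula.realize_iExs, Formula.realize_iExs] at key
      obtain ⟨i, hi⟩ := key.1 ⟨fun _ => m, (Formula.realize_iInf).2 fun φ => hsub φ.2⟩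
      exact ⟨i (), fun φ hφ => (Formula.realize_iInf).1 hi ⟨φ, hφ⟩⟩)
  refine ⟨m', IsElementaryRel.insert fun φ => ⟨fun h => hm' φ h, fun h => ?_⟩⟩
  by_contra hn
  exact hm' φ.not (by simpa [Formula.realize_not] using hn) h

/-- An element outside an elementary submodel is moved by an elementary relation fixing the
submodel. -/
theorem UPow.exists_ne [Countable L.Symbols] [Countable A] (κ : A ↪ₑ[L] UPow A) {y : UPow A}
    (hy : y ∉ Set.range κ) :
    ∃ y', y' ≠ y ∧ IsElementaryRel L (insert (y, y') (Set.range fun a => (κ a, κ a))) := by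
  let Φ : Set (L.Formula ((A ⊕ Unit) ⊕ Unit)) :=
    insert ((Term.var (Sum.inr ())).equal (Term.var (Sum.inl (Sum.inr ())))).not
      ((Formula.relabel (Sum.map Sum.inl id)) ''
        {φ : L.Formula (A ⊕ Unit) | φ.Realize (Sum.elim κ fun _ => y)})
  have hrel : ∀ (φ : L.Formula (A ⊕ Unit)) (m : UPow A),
      (Formula.relabel (Sum.map Sum.inl id) φ : L.Formula ((A ⊕ Unit) ⊕ Unit)).Realize
        (Sum.elim (Sum.elim κ fun _ => y) fun _ => m) ↔
      φ.Realize (Sum.elim κ fun _ => m) := by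
    intro φ m
    rw [Formula.realize_relabel]
    congr! 1
    funext i
    rcases i with _ | _ <;> rfl
  obtain ⟨y', hy'⟩ := UPow.exists_realize (L := L) (Sum.elim κ fun _ : Unit => y) Φ (by
    intro s hs hsub
    have := hs.to_subtype
    have hψ : ∀ ψ : s, ∃ φ : L.Formula (A ⊕ Unit), φ.Realize (Sum.elim κ fun _ => y) ∧
        ∀ a : A, φ.Realize (Sum.elim κ fun _ => κ a) →
          ψ.1.Realize (Sum.elim (Sum.elim κ fun _ => y) fun _ => κ a) := by
      rintro ⟨ψ, hψ⟩
      rcases hsub hψ with rfl | ⟨φ, hφ, rfl⟩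
      · refine ⟨⊤, by simp, fun a _ => ?_⟩
        simp only [Formula.realize_not, Formula.realize_equal, Term.realize_var, Sum.elim_inr,
          Sum.elim_inl]
        exact fun h => hy ⟨a, h⟩
      · exact ⟨φ, hφ, fun a ha => (hrel φ _).2 ha⟩
    choose g hgy hg using hψ
    have h1 : ((Formula.iInf g).iExs Unit).Realize (κ ∘ id) := by
      rw [Formula.realize_iExs]
      exact ⟨fun _ => y, Formula.realize_iInf.2 hgy⟩
    rw [κ.map_formula, Formula.realize_iExs] at h1
    obtain ⟨c, hc⟩ := h1
    refine ⟨κ (c ()), fun ψ hψ => hg ⟨ψ, hψ⟩ _ ?_⟩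
    have h2 := Formula.realize_iInf.1 ((κ.map_formula _ _).2 hc) ⟨ψ, hψ⟩
    convert h2 using 2
    funext i
    rcases i with _ | _ <;> rfl)
  have hne : y' ≠ y := by simpa [Formula.realize_equal] using hy' _ (mem_insert _ _)
  have htp : ∀ φ : L.Formula (A ⊕ Unit), φ.Realize (Sum.elim κ fun _ => y) →
      φ.Realize (Sum.elim κ fun _ => y') := fun φ hφ =>
    (hrel φ y').1 (hy' _ (mem_insert_of_mem _ ⟨φ, hφ, rfl⟩))
  refine ⟨y', hne, IsElementaryRel.insert fun φ => ?_⟩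
  choose g hg using fun r : Set.range fun a => (κ a, κ a) => r.2
  have h1 : ∀ m, φ.Realize (Sum.elim
      (fun r : Set.range fun a => (κ a, κ a) => r.1.1) fun _ => m) ↔
      (φ.relabel (Sum.map g id) : L.Formula (A ⊕ Unit)).Realize (Sum.elim κ fun _ => m) := by
    intro m
    rw [Formula.realize_relabel]
    refine iff_of_eq (congrArg _ ?_)
    funext i
    rcases i with r | _
    · exact (congrArg Prod.fst (hg r)).symm
    · rfl
  have h2 : (fun r : Set.range fun a => (κ a, κ a) => r.1.2) = fun r => r.1.1 := by
    funext r
    rw [← hg r]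
  rw [h2, h1, h1]
  refine ⟨htp _, fun h => ?_⟩
  by_contra hn
  exact Formula.realize_not.1 (htp (Formula.relabel (Sum.map g id) φ).not
    (Formula.realize_not.2 hn)) h

/-- The diagonal embedding of a structure in its ultrapower. -/
noncomputable def UPow.diag : A ↪ₑ[L] UPow A where
  toFun a := ((fun _ => a : ℕ → A) : UPow A)
  map_formula' n φ x := by
    have := Ultraproduct.realize_formula_cast (u := hyperfilter ℕ) φ (fun i _ => x i : _ → ℕ → A)
    exact this.trans (by simp)

theorem UPow.diag_surjective [Finite A] :
    Function.Surjective (UPow.diag : A ↪ₑ[L] UPow A) := by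
  intro m
  obtain ⟨f, rfl⟩ : ∃ f : ℕ → A, (f : UPow A) = m := Quotient.exists_rep m
  have h : ∃ a, ∀ᶠ n in (hyperfilter ℕ : Filter ℕ), f n = a := by
    have := (Ultrafilter.eventually_exists_iff (f := hyperfilter ℕ) (P := fun a n => f n = a))
    exact this.1 (Eventually.of_forall fun n => ⟨_, rfl⟩)
  obtain ⟨a, ha⟩ := h
  refine ⟨a, Quotient.sound ?_⟩
  filter_upwards [ha] with n hn
  exact hn.symm

/-- Finite elementary relations into an elementary submodel isomorphic to a saturated structure
can be extended within the submodel. -/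
theorem UPow.exists_insert [Countable L.Symbols] [Countable A] (hsat : IsSaturated L A)
    (κ : A ↪ₑ[L] UPow A) {R : Set (UPow A × UPow A)} (hfin : R.Finite)
    (hR : IsElementaryRel L R) (hran : ∀ p ∈ R, p.2 ∈ Set.range κ) (m : UPow A) :
    ∃ c, IsElementaryRel L (insert (m, κ c) R) := by
  obtain ⟨m', hm'⟩ := UPow.isCountablyHomogeneous R hfin.countable hR m
  rcases finite_or_infinite A with hA | hA
  · have hsurj : Function.Surjective κ := by
      have : Finite (UPow A) := Finite.of_surjective _ (UPow.diag_surjective (L := L))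
      exact (κ.injective.bijective_of_nat_card_le
        (Nat.card_le_card_of_surjective _ (UPow.diag_surjective (L := L)))).2
    obtain ⟨c, rfl⟩ := hsurj m'
    exact ⟨c, hm'⟩
  · have := hfin.to_subtype
    choose a ha using fun r : R => hran r r.2
    obtain ⟨c, hc⟩ := hsat R ((Cardinal.lt_aleph0_of_finite R).trans_le
      (Cardinal.aleph0_le_mk A)) (UPow A) inferInstance κ a m'
    refine ⟨c, IsElementaryRel.insert fun φ => ?_⟩
    have h1 := hm'.realize_iff (x := Sum.elim (fun r : R => r.1.1) fun _ => m)
      (y := Sum.elim (fun r : R => r.1.2) fun _ => m') (by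
        rintro (r | _)
        · exact Or.inr r.2
        · exact Or.inl rfl) φ
    have h2 : (κ ∘ a) = fun r : R => r.1.2 := funext ha
    have h3 := hc φ
    rw [h2, ← κ.map_formula, Sum.comp_elim, h2] at h3
    exact h1.trans h3

end Ultrapower

section Superhomogeneity

variable {L : FirstOrder.Language.{u, v}} {A : Type w} [L.Structure A]

theorem HasQE.realize_iff [Nonempty A] (hqe : HasQE L A) {C : Type*} [L.Structure C]
    (f g : C ↪[L] A) {n : ℕ} (φ : L.Formula (Fin n)) (x : Fin n → C) :
    φ.Realize (f ∘ x) ↔ φ.Realize (g ∘ x) := by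
  obtain ⟨ψ, hψ, h⟩ := hqe n φ
  have hf : ∀ f : C ↪[L] A, φ.Realize (f ∘ x) ↔ ψ.Realize x := by
    intro f
    rw [h.realize_iff (M := A)]
    have := hψ.realize_embedding f (v := x) (xs := default)
    rw [Subsingleton.elim (f ∘ default) (default : Fin 0 → A)] at this
    exact this
  exact (hf f).trans (hf g).symm

theorem IsElementaryPerm.exists_equiv {P : Type*} [L.Structure P] {θ : A ↪ₑ[L] P}
    {F : Set (P × P)} (hF : IsElementaryPerm L (Set.range θ) F) :
    ∃ g : A ≃[L] A, ∀ a, (θ a, θ (g a)) ∈ F := by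
  have h : ∀ a, ∃ b, (θ a, θ b) ∈ F := by
    intro a
    obtain ⟨y, hy⟩ := hF.exists_right _ ⟨a, rfl⟩
    obtain ⟨b, rfl⟩ := (hF.mem _ hy).2
    exact ⟨b, hy⟩
  choose g hg using h
  let e : A ↪ₑ[L] A := ⟨g, fun n φ x => by
    rw [← θ.map_formula φ (g ∘ x), ← θ.map_formula φ x]
    exact (hF.isElementaryRel.realize_iff (fun i => hg (x i)) φ).symm⟩
  have hsurj : Function.Surjective g := by
    intro b
    obtain ⟨x, hx⟩ := hF.exists_left _ ⟨b, rfl⟩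
    obtain ⟨a, rfl⟩ := (hF.mem _ hx).1
    exact ⟨a, θ.injective ((hF.isElementaryRel.eq_iff (hg a) hx).1 rfl)⟩
  exact ⟨{ toEquiv := Equiv.ofBijective g ⟨e.injective, hsurj⟩
           map_fun' := fun f x => e.map_fun f x
           map_rel' := fun r x => e.map_rel r x }, hg⟩

theorem isSuperhomogeneous_of_isElementaryPerm [Nonempty A] (hqe : HasQE L A) {P : Type*}
    [L.Structure P] (θ : A ↪ₑ[L] P) (V : L.Substructure A) {C : Set P}
    (hV : ∀ a, a ∈ V ↔ θ a ∈ C)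
    (hext : ∀ R : Set (P × P), R.Finite → IsElementaryRel L R → R ⊆ C ×ˢ C →
      ∃ F, R ⊆ F ∧ IsElementaryPerm L (Set.range θ) F ∧ ∀ p ∈ F, p.1 ∈ C ↔ p.2 ∈ C)
    (hmove : ∀ y ∈ Set.range θ, y ∉ C → ∃ F y', IsElementaryPerm L (Set.range θ) F ∧
      (∀ c ∈ C, (c, c) ∈ F) ∧ y' ≠ y ∧ (y, y') ∈ F) :
    IsSuperhomogeneous L A V := by
  refine ⟨fun S hS hfg f hf => ?_, fun y hy => ?_⟩
  · obtain ⟨t, rfl⟩ := hfg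
    have ht : ∀ s : t, s.1 ∈ Substructure.closure L (t : Set A) := fun s =>
      Substructure.subset_closure s.2
    let R : Set (P × P) := Set.range fun s : t => (θ s.1, θ (f ⟨s.1, ht s⟩))
    have hR : IsElementaryRel L R := by
      intro n φ x y hxy
      choose s hs using hxy
      have hx : x = θ ∘ (Substructure.subtype _) ∘ fun i => ⟨(s i).1, ht (s i)⟩ :=
        funext fun i => (congrArg Prod.fst (hs i)).symm
      have hy : y = θ ∘ f ∘ fun i => ⟨(s i).1, ht (s i)⟩ :=
        funext fun i => (congrArg Prod.snd (hs i)).symm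
      rw [hx, hy, θ.map_formula, θ.map_formula]
      exact hqe.realize_iff _ _ _ _
    obtain ⟨F, hRF, hF, hFC⟩ := hext R (Set.finite_range _) hR (by
      rintro _ ⟨s, rfl⟩
      exact ⟨(hV _).1 (hS (ht s)), (hV _).1 (hf _)⟩)
    obtain ⟨g, hg⟩ := hF.exists_equiv
    refine ⟨g, ?_, ?_⟩
    · have heq : ∀ s : t, g s.1 = f ⟨s.1, ht s⟩ := fun s => θ.injective
        ((hF.isElementaryRel.eq_iff (hg s.1) (hRF ⟨s, rfl⟩)).1 rfl)
      have hgf : g.toHom.comp (Substructure.subtype _).toHom = f.toHom := by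
        refine Hom.eq_of_eqOn_dense (s := (↑) ⁻¹' (t : Set A)) ?_ ?_
        · rw [eq_top_iff]
          rintro ⟨x, hx⟩ -
          induction hx using Substructure.closure_induction' with
          | Hs x hx => exact Substructure.subset_closure hx
          | Hfun f =>
            intro v hv
            choose hv ih using hv
            exact ⟨Substructure.fun_mem _ f v hv,
              (Substructure.closure L _).fun_mem f
                (fun i => (⟨v i, hv i⟩ : Substructure.closure L (t : Set A))) ih⟩
        · intro s hs
          exact heq ⟨s.1, hs⟩
      intro s
      exact DFunLike.congr_fun hgf s
    · have hgV : ∀ a, a ∈ V ↔ g a ∈ V := fun a => by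
        rw [hV, hV]
        exact hFC _ (hg a)
      ext b
      constructor
      · rintro ⟨a, ha, rfl⟩
        exact (hgV a).1 ha
      · intro hb
        refine ⟨g.symm b, (hgV _).2 ?_, g.apply_symm_apply b⟩
        rw [g.apply_symm_apply]
        exact hb
  · obtain ⟨F, y', hF, hfix, hne, hyy'⟩ := hmove (θ y) ⟨y, rfl⟩ fun h => hy ((hV y).2 h)
    obtain ⟨g, hg⟩ := hF.exists_equiv
    refine ⟨g, fun v hv => ?_, fun h => hne ?_⟩
    · exact θ.injective ((hF.isElementaryRel.eq_iff (hg v) (hfix _ ((hV v).1 hv))).1 rfl)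
    · have := (hF.isElementaryRel.eq_iff (hg y) hyy').1 rfl
      rw [h] at this
      exact this.symm

variable [Nonempty A] [Countable L.Symbols] [Countable A]

theorem UPow.exists_isElementaryPerm (hsat : IsSaturated L A) (κ : A ↪ₑ[L] UPow A)
    {R : Set (UPow A × UPow A)} (hfin : R.Finite) (hR : IsElementaryRel L R)
    (hsub : R ⊆ Set.range κ ×ˢ Set.range κ) :
    ∃ G, R ⊆ G ∧ G.Countable ∧ IsElementaryPerm L (Set.range κ) G := by
  obtain ⟨F, hmono, h0, hF, hX, hY⟩ := exists_chain
    (Q := fun R : Set (UPow A × UPow A) => R.Finite ∧ IsElementaryRel L R ∧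
      R ⊆ Set.range κ ×ˢ Set.range κ)
    (Set.countable_range κ) (Set.countable_range κ)
    (fun R ⟨h1, h2, h3⟩ x hx => by
      obtain ⟨c, hc⟩ := UPow.exists_insert hsat κ h1 h2 (fun p hp => (h3 hp).2) x
      exact ⟨κ c, h1.insert _, hc, Set.insert_subset ⟨hx, c, rfl⟩ h3⟩)
    (fun R ⟨h1, h2, h3⟩ y hy => by
      obtain ⟨c, hc⟩ := UPow.exists_insert hsat κ (h1.preimage Prod.swap_injective.injOn) h2.swap
        (fun p hp => (h3 hp).1) y
      refine ⟨κ c, h1.insert _, hc.swap.mono ?_, Set.insert_subset ⟨⟨c, rfl⟩, hy⟩ h3⟩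
      rintro p (rfl | hp)
      · exact Or.inl rfl
      · exact Or.inr hp)
    (R₀ := R) ⟨hfin, hR, hsub⟩
  refine ⟨⋃ k, F k, h0 ▸ subset_iUnion F 0, countable_iUnion fun k => (hF k).1.countable,
    IsElementaryRel.iUnion hmono fun k => (hF k).2.1, fun p hp => ?_, hX, hY⟩
  obtain ⟨k, hk⟩ := mem_iUnion.1 hp
  exact (hF k).2.2 hk

/-- A countable set `N` containing given elementary copies `κ j` of `A` in its ultrapower, which is
homogeneous and in which each `κ j` is superhomogeneous. -/
theorem UPow.exists_countable_set {J : Type*} [Countable J] (hsat : IsSaturated L A)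
    (κ : J → A ↪ₑ[L] UPow A) :
    ∃ N : Set (UPow A), N.Countable ∧ (∀ j, Set.range (κ j) ⊆ N) ∧
      (∀ R : Set (UPow A × UPow A), R.Finite → IsElementaryRel L R → R ⊆ N ×ˢ N →
        ∃ F, R ⊆ F ∧ IsElementaryPerm L N F) ∧
      (∀ j, ∀ R : Set (UPow A × UPow A), R.Finite → IsElementaryRel L R →
        R ⊆ Set.range (κ j) ×ˢ Set.range (κ j) → ∃ F, R ⊆ F ∧ IsElementaryPerm L N F ∧
          ∀ p ∈ F, p.1 ∈ Set.range (κ j) ↔ p.2 ∈ Set.range (κ j)) ∧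
      ∀ j, ∀ y ∈ N, y ∉ Set.range (κ j) → ∃ F y', IsElementaryPerm L N F ∧
        (∀ c ∈ Set.range (κ j), (c, c) ∈ F) ∧ y' ≠ y ∧ (y, y') ∈ F := by
  let K : J → Set (Set (UPow A × UPow A)) := fun j => {R | (R.Finite ∧
    R ⊆ Set.range (κ j) ×ˢ Set.range (κ j)) ∧ IsElementaryRel L R}
  have hK : ∀ j, ∀ R : K j, ∃ G, R.1 ⊆ G ∧ G.Countable ∧
      IsElementaryPerm L (Set.range (κ j)) G := fun j R =>
    UPow.exists_isElementaryPerm hsat (κ j) R.2.1.1 R.2.2 R.2.1.2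
  choose G hRG hGc hG using hK
  choose mv hmv hmvR using fun (j : J) (y : {y // y ∉ Set.range (κ j)}) =>
    UPow.exists_ne (κ j) y.2
  let D : (j : J) → {y // y ∉ Set.range (κ j)} → Set (UPow A × UPow A) := fun j y =>
    insert (y.1, mv j y) (Set.range fun a => (κ j a, κ j a))
  let Act : Set (UPow A) → Set (Set (UPow A × UPow A)) := fun T =>
    {R | (R.Finite ∧ R ⊆ T ×ˢ T) ∧ IsElementaryRel L R} ∪
      ((⋃ j, Set.range (G j)) ∪ ⋃ j, D j '' (Subtype.val ⁻¹' T))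
  have hAct : Monotone Act := by
    intro T T' h
    refine union_subset_union (fun R hR => ⟨⟨hR.1.1, hR.1.2.trans (prod_mono h h)⟩, hR.2⟩)
      (union_subset_union subset_rfl (iUnion_mono fun j => image_mono (preimage_mono h)))
  have hcount : ∀ T : Set (UPow A), T.Countable →
      {R : Set (UPow A × UPow A) | (R.Finite ∧ R ⊆ T ×ˢ T) ∧ IsElementaryRel L R}.Countable :=
    fun T hT => (Set.countable_ofPred_finite_subset (hT.prod hT)).mono fun R hR => hR.1
  obtain ⟨N, hS, hN, hcl⟩ := IsCountablyHomogeneous.exists_closed (L := L)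
    UPow.isCountablyHomogeneous Act hAct
    (fun S hS => (hcount S hS).union ((countable_iUnion fun j => by
        have := (hcount _ (Set.countable_range (κ j))).to_subtype
        exact Set.countable_range (G j)).union
      (countable_iUnion fun j => (hS.preimage Subtype.val_injective).image _)))
    (by
      rintro S R (hR | hR | hR)
      · exact ⟨hR.1.1.countable, hR.2⟩
      · obtain ⟨j, R, rfl⟩ := mem_iUnion.1 hR
        exact ⟨hGc j R, (hG j R).isElementaryRel⟩
      · obtain ⟨j, y, -, rfl⟩ := mem_iUnion.1 hR
        exact ⟨(Set.countable_range _).insert _, hmvR j y⟩)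
    (⋃ j, Set.range (κ j)) (countable_iUnion fun j => Set.countable_range _)
  refine ⟨N, hN, fun j => (subset_iUnion (fun j => Set.range (κ j)) j).trans hS,
    fun R hfin hR hsub => ?_, fun j R hfin hR hsub => ?_, fun j y hyN hy => ?_⟩
  · refine hcl (Prod.fst '' R ∪ Prod.snd '' R) ((hfin.image _).union (hfin.image _)) ?_ R
      (Or.inl ⟨⟨hfin, fun p hp => ⟨Or.inl ⟨p, hp, rfl⟩, Or.inr ⟨p, hp, rfl⟩⟩⟩, hR⟩)
    rintro _ (⟨p, hp, rfl⟩ | ⟨p, hp, rfl⟩)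
    · exact (hsub hp).1
    · exact (hsub hp).2
  · obtain ⟨F, hGF, hF⟩ := hcl ∅ finite_empty (empty_subset _) (G j ⟨R, ⟨hfin, hsub⟩, hR⟩)
      (Or.inr (Or.inl (mem_iUnion.2 ⟨j, ⟨_, rfl⟩⟩)))
    exact ⟨F, (hRG j _).trans hGF, hF, fun p hp => (hG j _).mem_iff hF.isElementaryRel hGF hp⟩
  · obtain ⟨F, hDF, hF⟩ := hcl {y} (finite_singleton _) (singleton_subset_iff.2 hyN)
      (D j ⟨y, hy⟩) (Or.inr (Or.inr (mem_iUnion.2 ⟨j, ⟨⟨y, hy⟩, rfl, rfl⟩⟩)))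
    refine ⟨F, mv j ⟨y, hy⟩, hF, ?_, hmv j ⟨y, hy⟩, hDF (mem_insert _ _)⟩
    rintro _ ⟨a, rfl⟩
    exact hDF (mem_insert_of_mem _ ⟨a, rfl⟩)

/-- A countable homogeneous set containing the diagonal is an elementary copy of `A`. -/
theorem UPow.exists_range_eq (hsat : IsSaturated L A) {N : Set (UPow A)} (hN : N.Countable)
    (hdiag : Set.range (UPow.diag : A ↪ₑ[L] UPow A) ⊆ N)
    (hhom : ∀ R : Set (UPow A × UPow A), R.Finite → IsElementaryRel L R → R ⊆ N ×ˢ N →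
      ∃ F, R ⊆ F ∧ IsElementaryPerm L N F) :
    ∃ θ : A ↪ₑ[L] UPow A, Set.range θ = N := by
  let ι : A ↪ₑ[L] UPow A := UPow.diag
  obtain ⟨R, hmono, -, hQ, hX, hY⟩ := exists_chain
    (Q := fun R : Set (UPow A × UPow A) => R.Finite ∧ IsElementaryRel L R ∧
      R ⊆ Set.range ι ×ˢ N) (Set.countable_range ι) hN
    (fun R ⟨h1, h2, h3⟩ x hx => by
      obtain ⟨F, hRF, hF⟩ := hhom R h1 h2 (h3.trans (prod_mono hdiag subset_rfl))
      obtain ⟨y, hy⟩ := hF.exists_right x (hdiag hx)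
      exact ⟨y, h1.insert _, hF.isElementaryRel.mono (Set.insert_subset hy hRF),
        Set.insert_subset ⟨hx, (hF.mem _ hy).2⟩ h3⟩)
    (fun R ⟨h1, h2, h3⟩ y hy => by
      obtain ⟨c, hc⟩ := UPow.exists_insert hsat ι (h1.preimage Prod.swap_injective.injOn) h2.swap
        (fun p hp => (h3 hp).1) y
      refine ⟨ι c, h1.insert _, hc.swap.mono ?_, Set.insert_subset ⟨⟨c, rfl⟩, hy⟩ h3⟩
      rintro p (rfl | hp)
      · exact Or.inl rfl
      · exact Or.inr hp)
    (R₀ := ∅) ⟨finite_empty, isElementaryRel_empty, empty_subset _⟩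
  have hR : IsElementaryRel L (⋃ k, R k) := IsElementaryRel.iUnion hmono fun k => (hQ k).2.1
  have hsub : ⋃ k, R k ⊆ Set.range ι ×ˢ N := iUnion_subset fun k => (hQ k).2.2
  choose θ hθ using fun a => hX (ι a) ⟨a, rfl⟩
  refine ⟨⟨θ, fun n φ x => ?_⟩, ?_⟩
  · rw [← ι.map_formula φ x]
    exact (hR.realize_iff (fun i => hθ (x i)) φ).symm
  · refine subset_antisymm ?_ fun y hy => ?_
    · rintro _ ⟨a, rfl⟩
      exact (hsub (hθ a)).2
    · obtain ⟨x, hx⟩ := hY y hy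
      obtain ⟨a, rfl⟩ := (hsub hx).1
      exact ⟨a, (hR.eq_iff (hθ a) hx).1 rfl⟩

end Superhomogeneity

/-- Let `A` be a smooth countable saturated structure and `B` a substructure
of `A` isomorphic to `A`. Then there is an extension `Ã` of `A` isomorphic to `A` in which both
`A` and `B` are superhomogeneous. -/
theorem statement_13 (L : FirstOrder.Language.{u, v}) (A : Type w) [L.Structure A]
    (hsm : Smooth L A) (B : L.Substructure A) (hiso : Nonempty (A ≃[L] B)) :
    ∃ (N : Type w) (SN : L.Structure N),
      letI := SN
      ∃ i : A ↪[L] N, Nonempty (N ≃[L] A) ∧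
        IsSuperhomogeneous L N i.toHom.range ∧
        IsSuperhomogeneous L N (B.map i.toHom) := by
  obtain ⟨hL, hA, hsat, hqe⟩ := hsm
  obtain ⟨e₀⟩ := hiso
  rcases isEmpty_or_nonempty A with hE | hN
  · have hsup : ∀ V : L.Substructure A, IsSuperhomogeneous L A V := fun V =>
      ⟨fun S _ _ f _ => ⟨Language.Equiv.refl L A, fun s => hE.elim s.1, by simp⟩,
        fun y => hE.elim y⟩
    exact ⟨A, inferInstance, Embedding.refl L A, ⟨Language.Equiv.refl L A⟩, hsup _, hsup _⟩
  have : Countable L.Symbols := Cardinal.mk_le_aleph0_iff.1 hL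
  let e : A ↪ₑ[L] A := ⟨(B.subtype.comp e₀.toEmbedding), fun n φ x =>
    hqe.realize_iff (B.subtype.comp e₀.toEmbedding) (Embedding.refl L A) φ x⟩
  have he : Set.range e = B := by
    ext b
    constructor
    · rintro ⟨a, rfl⟩
      exact (e₀ a).2
    · intro hb
      exact ⟨e₀.symm ⟨b, hb⟩, congrArg Subtype.val (e₀.apply_symm_apply ⟨b, hb⟩)⟩
  let ι : A ↪ₑ[L] UPow A := UPow.diag
  let κ : Bool → A ↪ₑ[L] UPow A := fun j => cond j ι (ι.comp e)
  obtain ⟨N, hNc, hκN, hhom, hext, hmove⟩ := UPow.exists_countable_set hsat κ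
  obtain ⟨θ, rfl⟩ := UPow.exists_range_eq hsat hNc (hκN true) hhom
  choose i hi using fun a => hκN true ⟨a, rfl⟩
  change ∀ a, θ (i a) = ι a at hi
  let i' : A ↪ₑ[L] A := ⟨i, fun n φ x => by
    rw [← θ.map_formula φ (i ∘ x), ← ι.map_formula φ x]
    exact iff_of_eq (congrArg _ (funext fun k => hi (x k)))⟩
  refine ⟨A, inferInstance, i'.toEmbedding, ⟨Language.Equiv.refl L A⟩,
    isSuperhomogeneous_of_isElementaryPerm hqe θ _ (fun a => ?_) (hext true) (hmove true),
    isSuperhomogeneous_of_isElementaryPerm hqe θ _ (fun a => ?_) (hext false) (hmove false)⟩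
  · constructor
    · rintro ⟨b, rfl⟩
      exact ⟨b, (hi b).symm⟩
    · rintro ⟨b, hb⟩
      exact ⟨b, θ.injective ((hi b).trans hb)⟩
  · constructor
    · rintro ⟨b, hb, rfl⟩
      rw [← he] at hb
      obtain ⟨c, rfl⟩ := hb
      exact ⟨c, (hi _).symm⟩
    · rintro ⟨c, hc⟩
      refine ⟨e c, ?_, θ.injective ((hi _).trans hc)⟩
      rw [← he]
      exact ⟨c, rfl⟩

end Paper
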